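/- The map A ↦ (χ_ij(A))_{1 ≤ i ≤ p, 1 ≤ j ≤ q} induces a well-defined bijection from the double coset space T_-(β_1,...,β_q)\GL(n,k)/T_+(α_1,...,α_p) onto the set of all bi-hinges. (Theorem 1.) -/

import Mathlib

namespace Neretin

open scoped BigOperators

variable {k : Type*} [Field k]

/-- Offset of the `i`-th block of the partition `α`. -/
def off {p : ℕ} (α : Fin p → ℕ) (i : Fin p) : ℕ := ∑ i' ∈ Finset.Iio i, α i'

theorem coord_lt {p n : ℕ} {α : Fin p → ℕ} (hα : ∑ i, α i = n) (i : Fin p)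
    (t : Fin (α i)) : off α i + (t : ℕ) < n := by
  have h1 : off α i + α i ≤ n := by
    rw [← hα]
    have h2 : insert i (Finset.Iio i) = Finset.Iic i := Finset.Iio_insert i
    have h3 : off α i + α i = ∑ i' ∈ Finset.Iic i, α i' := by
      rw [← h2, Finset.sum_insert (by simp)]
      unfold off
      omega
    rw [h3]
    exact Finset.sum_le_sum_of_subset (Finset.subset_univ _)
  have h4 := t.isLt
  omega

/-- The coordinate of `k^n` corresponding to the `t`-th coordinate of the `i`-th block. -/
def coord {p n : ℕ} {α : Fin p → ℕ} (hα : ∑ i, α i = n) (i : Fin p) (t : Fin (α i)) : Fin n :=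
  ⟨off α i + (t : ℕ), coord_lt hα i t⟩

/-- Subspace of vectors vanishing at all coordinates satisfying `P`. -/
def vanishOn {ι : Type*} (P : ι → Prop) : Submodule k (ι → k) :=
  ⨅ r ∈ {r : ι | P r}, LinearMap.ker (LinearMap.proj (R := k) (φ := fun _ : ι => k) r)

/-- The linear relation `χ_ij(A) : V_i ⇉ W_j`. -/
def chi {p q n : ℕ} (α : Fin p → ℕ) (β : Fin q → ℕ) (hα : ∑ i, α i = n) (hβ : ∑ j, β j = n)
    (A : Matrix (Fin n) (Fin n) k) (i : Fin p) (j : Fin q) :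
    Submodule k ((Fin (α i) → k) × (Fin (β j) → k)) :=
  Submodule.map
    ((LinearMap.funLeft k k (coord hα i)).prod
      ((LinearMap.funLeft k k (coord hβ j)).comp (Matrix.mulVecLin A)))
    (vanishOn (fun r : Fin n => off α i + α i ≤ (r : ℕ)) ⊓
      Submodule.comap (Matrix.mulVecLin A) (vanishOn fun r : Fin n => (r : ℕ) < off β j))

section Rel

variable {X Y : Type*} [AddCommGroup X] [Module k X] [AddCommGroup Y] [Module k Y]

/-- Kernel of a linear relation. -/
def rker (L : Submodule k (X × Y)) : Submodule k X := Submodule.comap (LinearMap.inl k X Y) L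

/-- Domain of a linear relation. -/
def rdom (L : Submodule k (X × Y)) : Submodule k X := Submodule.map (LinearMap.fst k X Y) L

/-- Image of a linear relation. -/
def rim (L : Submodule k (X × Y)) : Submodule k Y := Submodule.map (LinearMap.snd k X Y) L

/-- Indefiniteness of a linear relation. -/
def rindef (L : Submodule k (X × Y)) : Submodule k Y := Submodule.comap (LinearMap.inr k X Y) L

end Rel

/-- `blockLT α a b`: coordinate `a` lies in a strictly earlier block than `b`. -/
def blockLT {p : ℕ} (α : Fin p → ℕ) (a b : ℕ) : Prop :=
  ∃ i : Fin p, off α i ≤ b ∧ a < off α i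

/-- `sameBlock α a b` : coordinates `a`, `b` lie in the same block. -/
def sameBlock {p : ℕ} (α : Fin p → ℕ) (a b : ℕ) : Prop :=
  ∀ i : Fin p, off α i ≤ a ↔ off α i ≤ b

/-- Block upper triangular matrices (the group `P_+`). -/
def IsPPlus {n p : ℕ} (α : Fin p → ℕ) (g : Matrix (Fin n) (Fin n) k) : Prop :=
  ∀ r s : Fin n, blockLT α (s : ℕ) (r : ℕ) → g r s = 0

/-- Block lower triangular matrices (the group `P_-`). -/
def IsPMinus {n p : ℕ} (α : Fin p → ℕ) (g : Matrix (Fin n) (Fin n) k) : Prop :=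
  ∀ r s : Fin n, blockLT α (r : ℕ) (s : ℕ) → g r s = 0

/-- Block strictly upper triangular matrices (the group `T_+`). -/
def IsTPlus {n p : ℕ} (α : Fin p → ℕ) (g : Matrix (Fin n) (Fin n) k) : Prop :=
  IsPPlus α g ∧ ∀ r s : Fin n, sameBlock α (r : ℕ) (s : ℕ) → g r s = if r = s then 1 else 0

/-- Block strictly lower triangular matrices (the group `T_-`). -/
def IsTMinus {n p : ℕ} (α : Fin p → ℕ) (g : Matrix (Fin n) (Fin n) k) : Prop :=
  IsPMinus α g ∧ ∀ r s : Fin n, sameBlock α (r : ℕ) (s : ℕ) → g r s = if r = s then 1 else 0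

/-- Bi-hinges. -/
def IsBiHinge {p q : ℕ} (α : Fin p → ℕ) (β : Fin q → ℕ)
    (ξ : (i : Fin p) → (j : Fin q) → Submodule k ((Fin (α i) → k) × (Fin (β j) → k))) : Prop :=
  (∀ (i : Fin p) (j j' : Fin q), (j' : ℕ) = (j : ℕ) + 1 → rker (ξ i j) = rdom (ξ i j')) ∧
  (∀ (i i' : Fin p) (j : Fin q), (i' : ℕ) = (i : ℕ) + 1 → rim (ξ i j) = rindef (ξ i' j)) ∧
  (∀ (i : Fin p) (j : Fin q), (i : ℕ) = 0 → rindef (ξ i j) = ⊥) ∧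
  (∀ (i : Fin p) (j : Fin q), (i : ℕ) + 1 = p → rim (ξ i j) = ⊤) ∧
  (∀ (i : Fin p) (j : Fin q), (j : ℕ) + 1 = q → rker (ξ i j) = ⊥) ∧
  (∀ (i : Fin p) (j : Fin q), (j : ℕ) = 0 → rdom (ξ i j) = ⊤)

/-- 0-1 matrices with exactly one unit in each row and each column. -/
def IsPermMatrix {n : ℕ} (M : Matrix (Fin n) (Fin n) k) : Prop :=
  ∃ σ : Equiv.Perm (Fin n), ∀ r s, M r s = if r = σ s then 1 else 0

/-- Offset of the sub-block `V_i^j` inside `V_i`. -/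
def offA {p q : ℕ} (a : Fin p → Fin q → ℕ) (i : Fin p) (j : Fin q) : ℕ :=
  ∑ j' ∈ Finset.Iio j, a i j'

/-- Offset of the sub-block `W_j^i` inside `W_j`. -/
def offB {p q : ℕ} (a : Fin p → Fin q → ℕ) (i : Fin p) (j : Fin q) : ℕ :=
  ∑ i' ∈ Finset.Iio i, a i' j

open Classical in
/-- The standard 0-1 matrix determined by the dimension data `a`. -/
noncomputable def stdMatrix {p q : ℕ} (n : ℕ) (α : Fin p → ℕ) (β : Fin q → ℕ)
    (a : Fin p → Fin q → ℕ) : Matrix (Fin n) (Fin n) k :=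
  Matrix.of fun r s : Fin n =>
    if ∃ (i : Fin p) (j : Fin q) (t : ℕ), t < a i j ∧
        (s : ℕ) = off α i + offA a i j + t ∧ (r : ℕ) = off β j + offB a i j + t
      then (1 : k) else 0

/-- The standard bi-hinge determined by the dimension data `a`. -/
def stdHinge {p q : ℕ} (α : Fin p → ℕ) (β : Fin q → ℕ) (a : Fin p → Fin q → ℕ)
    (i : Fin p) (j : Fin q) : Submodule k ((Fin (α i) → k) × (Fin (β j) → k)) where
  carrier := {z | (∀ u : Fin (α i), (u : ℕ) < offA a i j → z.1 u = 0) ∧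
    (∀ v : Fin (β j), offB a i j + a i j ≤ (v : ℕ) → z.2 v = 0) ∧
    ∀ (u : Fin (α i)) (v : Fin (β j)) (t : ℕ), t < a i j →
      (u : ℕ) = offA a i j + t → (v : ℕ) = offB a i j + t → z.1 u = z.2 v}
  add_mem' := by
    rintro x y ⟨hx1, hx2, hx3⟩ ⟨hy1, hy2, hy3⟩
    refine ⟨fun u hu => ?_, fun v hv => ?_, fun u v t ht hu hv => ?_⟩
    · show x.1 u + y.1 u = 0
      rw [hx1 u hu, hy1 u hu, add_zero]
    · show x.2 v + y.2 v = 0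
      rw [hx2 v hv, hy2 v hv, add_zero]
    · show x.1 u + y.1 u = x.2 v + y.2 v
      rw [hx3 u v t ht hu hv, hy3 u v t ht hu hv]
  zero_mem' := ⟨fun _ _ => rfl, fun _ _ => rfl, fun _ _ _ _ _ _ => rfl⟩
  smul_mem' := by
    rintro c x ⟨hx1, hx2, hx3⟩
    refine ⟨fun u hu => ?_, fun v hv => ?_, fun u v t ht hu hv => ?_⟩
    · show c * x.1 u = 0
      rw [hx1 u hu, mul_zero]
    · show c * x.2 v = 0
      rw [hx2 v hv, mul_zero]
    · show c * x.1 u = c * x.2 v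
      rw [hx3 u v t ht hu hv]

/-! ### Unipotent block-triangular endomorphisms of a product -/

section Unip

variable {ι : Type*} {V : ι → Type*} [∀ i, AddCommGroup (V i)] [∀ i, Module k (V i)]

/-- `C` is unipotent triangular with respect to `R`: it fixes the `i`-th component of every vector
whose components beyond `i` vanish. -/
def IsUnip (R : ι → ι → Prop) (C : ((i : ι) → V i) →ₗ[k] ((i : ι) → V i)) : Prop :=
  ∀ i x, (∀ i', R i i' → x i' = 0) → C x i = x i

variable {R : ι → ι → Prop}

theorem IsUnip.apply_eq_zero [IsTrans ι R] {C : ((i : ι) → V i) →ₗ[k] ((i : ι) → V i)}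
    (hC : IsUnip R C) {i : ι} {x : (i : ι) → V i} (hx : ∀ i', R i i' → x i' = 0) :
    ∀ i', R i i' → C x i' = 0 := fun i' hi' => by
  rw [hC i' x fun i'' h => hx i'' (_root_.trans hi' h), hx i' hi']

theorem IsUnip.comp [IsTrans ι R] {C D : ((i : ι) → V i) →ₗ[k] ((i : ι) → V i)}
    (hC : IsUnip R C) (hD : IsUnip R D) : IsUnip R (D ∘ₗ C) := fun i x hx => by
  rw [LinearMap.comp_apply, hD i _ (hC.apply_eq_zero hx), hC i x hx]

theorem IsUnip.eq_zero_of_apply [Finite ι] [IsStrictOrder ι R]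
    {C : ((i : ι) → V i) →ₗ[k] ((i : ι) → V i)}
    (hC : IsUnip R C) {i : ι} {x : (i : ι) → V i} (hx : ∀ i', R i i' → C x i' = 0) :
    ∀ i', R i i' → x i' = 0 := by
  have wf : WellFounded (Function.swap R) := Finite.wellFounded_of_trans_of_irrefl _
  intro i'
  induction i' using wf.induction with
  | _ i' ih =>
    intro hi'
    rw [← hC i' x fun i'' h => ih i'' h (_root_.trans hi' h), hx i' hi']

theorem IsUnip.injective [Finite ι] [IsStrictOrder ι R]
    {C : ((i : ι) → V i) →ₗ[k] ((i : ι) → V i)} (hC : IsUnip R C) : Function.Injective C := by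
  rw [injective_iff_map_eq_zero]
  intro x hx
  ext i
  rw [← hC i x (hC.eq_zero_of_apply fun i' _ => by rw [hx]; rfl), hx]

theorem IsUnip.symm [Finite ι] [IsStrictOrder ι R] {C : ((i : ι) → V i) ≃ₗ[k] ((i : ι) → V i)}
    (hC : IsUnip R C.toLinearMap) : IsUnip R C.symm.toLinearMap := fun i x hx => by
  have h := hC i (C.symm x) (hC.eq_zero_of_apply fun i' hi' => by simpa using hx i' hi')
  simpa using h.symm

/-- A unipotent endomorphism as an automorphism. -/
noncomputable def IsUnip.toEquiv [Finite ι] [IsStrictOrder ι R] [∀ i, FiniteDimensional k (V i)]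
    {C : ((i : ι) → V i) →ₗ[k] ((i : ι) → V i)} (hC : IsUnip R C) :
    ((i : ι) → V i) ≃ₗ[k] ((i : ι) → V i) :=
  LinearEquiv.ofInjectiveEndo C hC.injective

end Unip

/-! ### Relations attached to a map between products -/

section RelChi

variable {ι κ : Type*} [LinearOrder ι] [LinearOrder κ] {V : ι → Type*} {W : κ → Type*}
  [∀ i, AddCommGroup (V i)] [∀ i, Module k (V i)] [∀ j, AddCommGroup (W j)] [∀ j, Module k (W j)]

/-- Vectors supported in blocks up to `i` whose image is supported in blocks from `j` on. -/
def bifilt (A : ((i : ι) → V i) →ₗ[k] ((j : κ) → W j)) (i : ι) (j : κ) :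
    Submodule k ((i : ι) → V i) where
  carrier := {x | (∀ i', i < i' → x i' = 0) ∧ ∀ j', j' < j → A x j' = 0}
  add_mem' := by
    rintro x y ⟨hx, hx'⟩ ⟨hy, hy'⟩
    exact ⟨fun i' h => by simp [hx i' h, hy i' h], fun j' h => by simp [hx' j' h, hy' j' h]⟩
  zero_mem' := by simp
  smul_mem' := by
    rintro c x ⟨hx, hx'⟩
    exact ⟨fun i' h => by simp [hx i' h], fun j' h => by simp [hx' j' h]⟩

/-- The relation between the `i`-th source block and the `j`-th target block cut out by `A`. -/
def relChi (A : ((i : ι) → V i) →ₗ[k] ((j : κ) → W j)) (i : ι) (j : κ) :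
    Submodule k (V i × W j) :=
  Submodule.map ((LinearMap.proj i).prod (LinearMap.proj j ∘ₗ A)) (bifilt A i j)

theorem mem_relChi {A : ((i : ι) → V i) →ₗ[k] ((j : κ) → W j)} {i : ι} {j : κ} {z : V i × W j} :
    z ∈ relChi A i j ↔ ∃ x : (i : ι) → V i, (∀ i', i < i' → x i' = 0) ∧
      (∀ j', j' < j → A x j' = 0) ∧ x i = z.1 ∧ A x j = z.2 := by
  constructor
  · rintro ⟨x, ⟨h1, h2⟩, rfl⟩
    exact ⟨x, h1, h2, rfl, rfl⟩
  · rintro ⟨x, h1, h2, h3, h4⟩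
    exact ⟨x, ⟨h1, h2⟩, Prod.ext h3 h4⟩

theorem relChi_le_of_unip [Finite ι] [Finite κ]
    (A : ((i : ι) → V i) ≃ₗ[k] ((j : κ) → W j))
    {B : ((j : κ) → W j) ≃ₗ[k] ((j : κ) → W j)} {C : ((i : ι) → V i) ≃ₗ[k] ((i : ι) → V i)}
    (hB : IsUnip (· > ·) B.toLinearMap) (hC : IsUnip (· < ·) C.toLinearMap) (i : ι) (j : κ) :
    relChi (C.trans (A.trans B)).toLinearMap i j ≤ relChi A.toLinearMap i j := by
  intro z hz
  obtain ⟨x, h1, h2, h3, h4⟩ := mem_relChi.1 hz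
  have h5 := hB.eq_zero_of_apply (i := j) (x := A (C x)) h2
  refine mem_relChi.2 ⟨C x, hC.apply_eq_zero h1, h5, ?_, ?_⟩
  · rw [← h3]; exact hC i x h1
  · rw [← h4]; exact (hB j _ h5).symm

theorem relChi_eq_of_unip [Finite ι] [Finite κ]
    (A : ((i : ι) → V i) ≃ₗ[k] ((j : κ) → W j))
    {B : ((j : κ) → W j) ≃ₗ[k] ((j : κ) → W j)} {C : ((i : ι) → V i) ≃ₗ[k] ((i : ι) → V i)}
    (hB : IsUnip (· > ·) B.toLinearMap) (hC : IsUnip (· < ·) C.toLinearMap) (i : ι) (j : κ) :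
    relChi (C.trans (A.trans B)).toLinearMap i j = relChi A.toLinearMap i j := by
  refine le_antisymm (relChi_le_of_unip A hB hC i j) ?_
  have h := relChi_le_of_unip (C.trans (A.trans B)) hB.symm hC.symm i j
  have h' : C.symm.trans ((C.trans (A.trans B)).trans B.symm) = A := by ext; simp
  rwa [h'] at h

end RelChi

/-! ### Splitting relations and filtrations -/

section Split

theorem mem_rker {X Y : Type*} [AddCommGroup X] [Module k X] [AddCommGroup Y] [Module k Y]
    {L : Submodule k (X × Y)} {x : X} : x ∈ rker L ↔ (x, (0 : Y)) ∈ L := Iff.rfl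

theorem mem_rindef {X Y : Type*} [AddCommGroup X] [Module k X] [AddCommGroup Y] [Module k Y]
    {L : Submodule k (X × Y)} {y : Y} : y ∈ rindef L ↔ ((0 : X), y) ∈ L := Iff.rfl

theorem mem_rdom {X Y : Type*} [AddCommGroup X] [Module k X] [AddCommGroup Y] [Module k Y]
    {L : Submodule k (X × Y)} {x : X} : x ∈ rdom L ↔ ∃ y, (x, y) ∈ L := by
  simp [rdom]

theorem mem_rim {X Y : Type*} [AddCommGroup X] [Module k X] [AddCommGroup Y] [Module k Y]
    {L : Submodule k (X × Y)} {y : Y} : y ∈ rim L ↔ ∃ x, (x, y) ∈ L := by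
  simp [rim]

/-- A relation is the sum of its kernel, its indefiniteness and a transversal part. -/
theorem exists_transversal {X Y : Type*} [AddCommGroup X] [Module k X] [AddCommGroup Y]
    [Module k Y] (L : Submodule k (X × Y)) :
    ∃ G ≤ L, (∀ z ∈ L, ∃ g ∈ G, z.1 - g.1 ∈ rker L ∧ z.2 - g.2 ∈ rindef L) ∧
      (∀ g ∈ G, g.1 ∈ rker L → g = 0) ∧ ∀ g ∈ G, g.2 ∈ rindef L → g = 0 := by
  obtain ⟨G, hG⟩ := Submodule.exists_isCompl ((rker L).prod (rindef L))
  have key : ∀ g ∈ L ⊓ G, g.1 ∈ rker L → g.2 ∈ rindef L → g = 0 := fun g hg h1 h2 =>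
    (Submodule.disjoint_def.1 hG.disjoint) g ⟨h1, h2⟩ hg.2
  have hsub : ∀ a ∈ (rker L).prod (rindef L), a ∈ L := by
    rintro ⟨a, b⟩ ⟨ha, hb⟩
    simpa using L.add_mem (mem_rker.1 ha) (mem_rindef.1 hb)
  refine ⟨L ⊓ G, inf_le_left, fun z hz => ?_, fun g hg h => key g hg h ?_,
    fun g hg h => key g hg ?_ h⟩
  · have hz' : z ∈ (rker L).prod (rindef L) ⊔ G := by rw [hG.sup_eq_top]; trivial
    obtain ⟨a, ha, g, hg, rfl⟩ := Submodule.mem_sup.1 hz'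
    refine ⟨g, ⟨?_, hg⟩, ?_⟩
    · simpa using L.sub_mem hz (hsub a ha)
    · simpa using ha
  · rw [mem_rindef]
    convert L.sub_mem hg.1 (mem_rker.1 h) using 1
    exact Prod.ext (by simp) (by simp)
  · rw [mem_rker]
    convert L.sub_mem hg.1 (mem_rindef.1 h) using 1
    exact Prod.ext (by simp) (by simp)

/-- Complements of the successive steps of a filtration add up to the whole space. -/
theorem bijective_sum_of_filtration {ι V : Type*} [Fintype ι] (R : ι → ι → Prop)
    [IsStrictTotalOrder ι R] [AddCommGroup V] [Module k V] {G : ι → Type*}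
    [∀ j, AddCommGroup (G j)] [∀ j, Module k (G j)] (f : (j : ι) → G j →ₗ[k] V)
    (D N : ι → Submodule k V) (hf : ∀ j g, f j g ∈ D j)
    (hD : ∀ j, ∀ v ∈ D j, ∃ g, v - f j g ∈ N j)
    (hN : ∀ j g, f j g ∈ N j → g = 0) (hDN : ∀ j j', R j j' → D j' ≤ N j)
    (hND : ∀ j, ∀ v ∈ N j, v = 0 ∨ ∃ j', R j j' ∧ v ∈ D j') (htop : ∀ v, ∃ j, v ∈ D j) :
    Function.Bijective fun e : (j : ι) → G j => ∑ j, f j (e j) := by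
  classical
  let F : ((j : ι) → G j) →ₗ[k] V := ∑ j, f j ∘ₗ LinearMap.proj j
  have hF : (fun e : (j : ι) → G j => ∑ j, f j (e j)) = F := by ext e; simp [F]
  rw [hF]
  constructor
  · rw [injective_iff_map_eq_zero]
    intro e he
    have he' : ∑ j, f j (e j) = 0 := by simpa [F] using he
    have wf : WellFounded R := Finite.wellFounded_of_trans_of_irrefl _
    ext j
    induction j using wf.induction with
    | _ j ih =>
      apply hN j
      rw [← Finset.add_sum_erase _ _ (Finset.mem_univ j)] at he'
      rw [eq_neg_of_add_eq_zero_left he']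
      refine (N j).neg_mem ((N j).sum_mem fun j' hj' => ?_)
      rcases trichotomous_of R j j' with h | h | h
      · exact hDN j j' h (hf j' _)
      · exact absurd h.symm (Finset.ne_of_mem_erase hj')
      · rw [ih j' h]; simp
  · have wf : WellFounded (Function.swap R) := Finite.wellFounded_of_trans_of_irrefl _
    have key : ∀ j, ∀ v ∈ D j, v ∈ LinearMap.range F := by
      intro j
      induction j using wf.induction with
      | _ j ih =>
        intro v hv
        obtain ⟨g, hg⟩ := hD j v hv
        have h1 : f j g ∈ LinearMap.range F := by
          refine ⟨Pi.single j g, ?_⟩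
          rw [← hF]
          refine (Finset.sum_eq_single j (fun j' _ h => ?_) (by simp)).trans (by simp)
          simp [h]
        have h2 : v - f j g ∈ LinearMap.range F := by
          rcases hND j _ hg with h | ⟨j', hj', h⟩
          · rw [h]; exact zero_mem _
          · exact ih j' hj' _ h
        simpa using add_mem h2 h1
    intro v
    obtain ⟨j, hj⟩ := htop v
    exact key j v hj

end Split

/-! ### Bi-hinges -/

section BiHinge

variable {p q : ℕ} {α : Fin p → ℕ} {β : Fin q → ℕ}
  {ξ η : (i : Fin p) → (j : Fin q) → Submodule k ((Fin (α i) → k) × (Fin (β j) → k))}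

theorem IsBiHinge.mem_rker_iff (h : IsBiHinge α β ξ) {i : Fin p} {j : Fin q} {v : Fin (α i) → k} :
    v ∈ rker (ξ i j) ↔ v = 0 ∨ ∃ j', j < j' ∧ v ∈ rdom (ξ i j') := by
  constructor
  · intro hv
    by_cases hj : (j : ℕ) + 1 = q
    · rw [h.2.2.2.2.1 i j hj] at hv
      exact Or.inl hv
    · have hj' : (j : ℕ) + 1 < q := by omega
      rw [h.1 i j ⟨j + 1, hj'⟩ rfl] at hv
      exact Or.inr ⟨_, Fin.lt_def.2 (Nat.lt_succ_self _), hv⟩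
  · rintro (rfl | ⟨j', hj', hv⟩)
    · exact zero_mem _
    · obtain ⟨m, hm⟩ := j'
      induction m with
      | zero => exact absurd (Fin.lt_def.1 hj') (by simp)
      | succ m ih =>
        rw [← h.1 i ⟨m, by omega⟩ ⟨m + 1, hm⟩ rfl] at hv
        rcases eq_or_lt_of_le (Nat.lt_succ_iff.1 (Fin.lt_def.1 hj')) with hjm | hjm
        · have : j = ⟨m, by omega⟩ := Fin.ext hjm
          rwa [this]
        · exact ih _ (Fin.lt_def.2 hjm) (mem_rdom.2 ⟨0, mem_rker.1 hv⟩)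

theorem IsBiHinge.mem_rindef_iff (h : IsBiHinge α β ξ) {i : Fin p} {j : Fin q}
    {w : Fin (β j) → k} :
    w ∈ rindef (ξ i j) ↔ w = 0 ∨ ∃ i', i' < i ∧ w ∈ rim (ξ i' j) := by
  obtain ⟨m, hm⟩ := i
  induction m with
  | zero =>
    rw [h.2.2.1 _ j rfl]
    simp [Fin.lt_def]
  | succ m ih =>
    have hs := h.2.1 ⟨m, by omega⟩ ⟨m + 1, hm⟩ j rfl
    constructor
    · intro hw
      rw [← hs] at hw
      exact Or.inr ⟨_, Fin.lt_def.2 (Nat.lt_succ_self _), hw⟩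
    · rintro (rfl | ⟨i', hi', hw⟩)
      · exact zero_mem _
      · rw [← hs]
        rcases eq_or_lt_of_le (Nat.lt_succ_iff.1 (Fin.lt_def.1 hi')) with him | him
        · have : i' = ⟨m, by omega⟩ := Fin.ext him
          rwa [← this]
        · exact mem_rim.2 ⟨0, mem_rindef.1 ((ih _).2 (Or.inr ⟨i', Fin.lt_def.2 him, hw⟩))⟩

theorem IsBiHinge.exists_mem_rdom (h : IsBiHinge α β ξ) (hq : 0 < q) (i : Fin p)
    (v : Fin (α i) → k) : ∃ j, v ∈ rdom (ξ i j) :=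
  ⟨⟨0, hq⟩, by rw [h.2.2.2.2.2 i _ rfl]; trivial⟩

theorem IsBiHinge.exists_mem_rim (h : IsBiHinge α β ξ) (hp : 0 < p) (j : Fin q)
    (w : Fin (β j) → k) : ∃ i, w ∈ rim (ξ i j) :=
  ⟨⟨p - 1, by omega⟩, by rw [h.2.2.2.1 _ j (Nat.sub_add_cancel hp)]; trivial⟩

/-- Bi-hinges are maximal: an inclusion between two of them is an equality. -/
theorem IsBiHinge.eq_of_le (hξ : IsBiHinge α β ξ) (hη : IsBiHinge α β η)
    (hle : ∀ i j, ξ i j ≤ η i j) (i : Fin p) (j : Fin q) : ξ i j = η i j := by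
  have of_rdom_rindef : ∀ i j, rdom (η i j) = rdom (ξ i j) → rindef (η i j) = rindef (ξ i j) →
      ξ i j = η i j := by
    intro i j hd hi
    refine le_antisymm (hle i j) ?_
    rintro ⟨v, w⟩ hz
    have hv : v ∈ rdom (ξ i j) := hd ▸ mem_rdom.2 ⟨w, hz⟩
    obtain ⟨w', hw'⟩ := mem_rdom.1 hv
    have h1 : w - w' ∈ rindef (ξ i j) := by
      rw [← hi, mem_rindef]
      simpa using (η i j).sub_mem hz (hle i j hw')
    simpa using (ξ i j).add_mem hw' (mem_rindef.1 h1)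
  obtain ⟨a, ha⟩ := i
  induction a generalizing j with
  | zero =>
    obtain ⟨b, hb⟩ := j
    induction b with
    | zero =>
      refine of_rdom_rindef _ _ ?_ ?_
      · rw [hξ.2.2.2.2.2 _ _ rfl, hη.2.2.2.2.2 _ _ rfl]
      · rw [hξ.2.2.1 _ _ rfl, hη.2.2.1 _ _ rfl]
    | succ b ihb =>
      refine of_rdom_rindef _ _ ?_ ?_
      · rw [← hξ.1 _ ⟨b, by omega⟩ ⟨b + 1, hb⟩ rfl, ← hη.1 _ ⟨b, by omega⟩ ⟨b + 1, hb⟩ rfl, ihb]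
      · rw [hξ.2.2.1 _ _ rfl, hη.2.2.1 _ _ rfl]
  | succ a iha =>
    have hind : ∀ j, rindef (η ⟨a + 1, ha⟩ j) = rindef (ξ ⟨a + 1, ha⟩ j) := fun j => by
      rw [← hξ.2.1 ⟨a, by omega⟩ ⟨a + 1, ha⟩ j rfl, ← hη.2.1 ⟨a, by omega⟩ ⟨a + 1, ha⟩ j rfl, iha]
    obtain ⟨b, hb⟩ := j
    induction b with
    | zero =>
      refine of_rdom_rindef _ _ ?_ (hind _)
      rw [hξ.2.2.2.2.2 _ _ rfl, hη.2.2.2.2.2 _ _ rfl]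
    | succ b ihb =>
      refine of_rdom_rindef _ _ ?_ (hind _)
      rw [← hξ.1 _ ⟨b, by omega⟩ ⟨b + 1, hb⟩ rfl, ← hη.1 _ ⟨b, by omega⟩ ⟨b + 1, hb⟩ rfl, ihb]

theorem isBiHinge_relChi
    (A : ((i : Fin p) → Fin (α i) → k) ≃ₗ[k] ((j : Fin q) → Fin (β j) → k)) :
    IsBiHinge α β (relChi A.toLinearMap) := by
  refine ⟨fun i j j' hj => ?_, fun i i' j hi => ?_, fun i j hi => ?_, fun i j hi => ?_,
    fun i j hj => ?_, fun i j hj => ?_⟩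
  · ext v
    rw [mem_rker, mem_rdom, mem_relChi]
    constructor
    · rintro ⟨x, h1, h2, h3, h4⟩
      refine ⟨A x j', mem_relChi.2 ⟨x, h1, fun l hl => ?_, h3, rfl⟩⟩
      rcases eq_or_lt_of_le (Nat.lt_succ_iff.1 (hj ▸ Fin.lt_def.1 hl)) with h | h
      · rw [Fin.ext h]; exact h4
      · exact h2 l h
    · rintro ⟨w, hw⟩
      obtain ⟨x, h1, h2, h3, h4⟩ := mem_relChi.1 hw
      exact ⟨x, h1, fun l hl => h2 l (Fin.lt_def.2 (by have := Fin.lt_def.1 hl; omega)), h3,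
        h2 j (Fin.lt_def.2 (by omega))⟩
  · ext w
    rw [mem_rim, mem_rindef, mem_relChi]
    constructor
    · rintro ⟨v, hv⟩
      obtain ⟨x, h1, h2, h3, h4⟩ := mem_relChi.1 hv
      exact ⟨x, fun l hl => h1 l (Fin.lt_def.2 (by have := Fin.lt_def.1 hl; omega)), h2,
        h1 i' (Fin.lt_def.2 (by omega)), h4⟩
    · rintro ⟨x, h1, h2, h3, h4⟩
      refine ⟨x i, mem_relChi.2 ⟨x, fun l hl => ?_, h2, rfl, h4⟩⟩
      by_cases h : l = i'
      · rw [h]; exact h3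
      · have h5 : (l : ℕ) ≠ i' := fun h' => h (Fin.ext h')
        exact h1 l (Fin.lt_def.2 (by have := Fin.lt_def.1 hl; omega))
  · rw [eq_bot_iff]
    intro w hw
    obtain ⟨x, h1, -, h3, h4⟩ := mem_relChi.1 (mem_rindef.1 hw)
    have hx : x = 0 := by
      ext1 l
      by_cases h : l = i
      · rw [h]; exact h3
      · have h5 : (l : ℕ) ≠ i := fun h' => h (Fin.ext h')
        exact h1 l (Fin.lt_def.2 (by omega))
    rw [hx] at h4
    simpa using h4.symm
  · rw [eq_top_iff]
    intro w _
    refine mem_rim.2 ⟨A.symm (Pi.single j w) i, mem_relChi.2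
      ⟨A.symm (Pi.single j w), fun l hl => ?_, fun l hl => ?_, rfl, ?_⟩⟩
    · have := Fin.lt_def.1 hl
      omega
    · simp [hl.ne]
    · simp
  · rw [eq_bot_iff]
    intro v hv
    obtain ⟨x, -, h2, h3, h4⟩ := mem_relChi.1 (mem_rker.1 hv)
    have hx : A x = 0 := by
      ext1 l
      by_cases h : l = j
      · rw [h]; exact h4
      · have h5 : (l : ℕ) ≠ j := fun h' => h (Fin.ext h')
        exact h2 l (Fin.lt_def.2 (by omega))
    rw [A.map_eq_zero_iff] at hx
    rw [hx] at h3
    simpa using h3.symm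
  · rw [eq_top_iff]
    intro v _
    refine mem_rdom.2 ⟨A (Pi.single i v) j, mem_relChi.2
      ⟨Pi.single i v, fun l hl => ?_, fun l hl => ?_, by simp, rfl⟩⟩
    · simp [hl.ne']
    · have := Fin.lt_def.1 hl
      omega

/-- Every bi-hinge is realized by an isomorphism, unique up to unipotent factors. -/
theorem IsBiHinge.exists_normal_form (h : IsBiHinge α β ξ) (hp : 0 < p) (hq : 0 < q) :
    ∃ A₀ : ((i : Fin p) → Fin (α i) → k) ≃ₗ[k] ((j : Fin q) → Fin (β j) → k),
      (∀ i j, relChi A₀.toLinearMap i j = ξ i j) ∧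
      ∀ A : ((i : Fin p) → Fin (α i) → k) ≃ₗ[k] ((j : Fin q) → Fin (β j) → k),
        (∀ i j, relChi A.toLinearMap i j = ξ i j) →
        ∃ (B : ((j : Fin q) → Fin (β j) → k) ≃ₗ[k] ((j : Fin q) → Fin (β j) → k))
          (C : ((i : Fin p) → Fin (α i) → k) ≃ₗ[k] ((i : Fin p) → Fin (α i) → k)),
          IsUnip (· > ·) B.toLinearMap ∧ IsUnip (· < ·) C.toLinearMap ∧
            C.trans A = A₀.trans B := by
  choose G hGle hGsum hGker hGindef using fun i j => exists_transversal (ξ i j)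
  have hrow : ∀ i, Function.Bijective
      fun e : (j : Fin q) → G i j => ∑ j, ((e j : (Fin (α i) → k) × (Fin (β j) → k))).1 := by
    intro i
    refine bijective_sum_of_filtration (k := k) (G := fun j => G i j) (· < ·)
      (fun j => LinearMap.fst k _ _ ∘ₗ (G i j).subtype)
      (fun j => rdom (ξ i j)) (fun j => rker (ξ i j)) (fun j g => ?_) (fun j v hv => ?_)
      (fun j g hg => ?_) (fun j j' hj v hv => ?_) (fun j v hv => h.mem_rker_iff.1 hv)
      (h.exists_mem_rdom hq i)
    · exact mem_rdom.2 ⟨g.1.2, hGle i j g.2⟩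
    · obtain ⟨w, hw⟩ := mem_rdom.1 hv
      obtain ⟨g, hg, h1, -⟩ := hGsum i j _ hw
      exact ⟨⟨g, hg⟩, h1⟩
    · exact Subtype.ext (hGker i j g g.2 hg)
    · exact h.mem_rker_iff.2 (Or.inr ⟨j', hj, hv⟩)
  have hcol : ∀ j, Function.Bijective
      fun e : (i : Fin p) → G i j => ∑ i, ((e i : (Fin (α i) → k) × (Fin (β j) → k))).2 := by
    intro j
    refine bijective_sum_of_filtration (k := k) (G := fun i => G i j) (· > ·)
      (fun i => LinearMap.snd k _ _ ∘ₗ (G i j).subtype)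
      (fun i => rim (ξ i j)) (fun i => rindef (ξ i j)) (fun i g => ?_) (fun i w hw => ?_)
      (fun i g hg => ?_) (fun i i' hi w hw => ?_) (fun i w hw => h.mem_rindef_iff.1 hw)
      (h.exists_mem_rim hp j)
    · exact mem_rim.2 ⟨g.1.1, hGle i j g.2⟩
    · obtain ⟨v, hv⟩ := mem_rim.1 hw
      obtain ⟨g, hg, -, h1⟩ := hGsum i j _ hv
      exact ⟨⟨g, hg⟩, h1⟩
    · exact Subtype.ext (hGindef i j g g.2 hg)
    · exact h.mem_rindef_iff.2 (Or.inr ⟨i', hi, hw⟩)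
  let P : ((i : Fin p) → (j : Fin q) → G i j) →ₗ[k] ((i : Fin p) → Fin (α i) → k) :=
    { toFun := fun e i => ∑ j, (e i j).1.1
      map_add' := fun e e' => by ext1 i; simp [Finset.sum_add_distrib]
      map_smul' := fun c e => by ext1 i; simp [Finset.smul_sum] }
  let Q : ((i : Fin p) → (j : Fin q) → G i j) →ₗ[k] ((j : Fin q) → Fin (β j) → k) :=
    { toFun := fun e j => ∑ i, (e i j).1.2
      map_add' := fun e e' => by ext1 i; simp [Finset.sum_add_distrib]
      map_smul' := fun c e => by ext1 i; simp [Finset.smul_sum] }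
  have P_apply : ∀ e i, P e i = ∑ j, (e i j).1.1 := fun _ _ => rfl
  have Q_apply : ∀ e j, Q e j = ∑ i, (e i j).1.2 := fun _ _ => rfl
  have hPe : ∀ e i, P e i = 0 → e i = 0 := fun e i he =>
    (hrow i).1 (he.trans (by simp))
  have hQe : ∀ e j, Q e j = 0 → ∀ i, e i j = 0 := fun e j he i =>
    congrFun ((hcol j).1 (a₁ := fun i => e i j) (a₂ := 0) (he.trans (by simp))) i
  have hP : Function.Bijective P := by
    refine ⟨(injective_iff_map_eq_zero P).2 fun e he =>
      funext fun i => hPe e i (congrFun he i), fun x => ?_⟩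
    choose e he using fun i => (hrow i).2 (x i)
    exact ⟨e, funext he⟩
  have hQ : Function.Bijective Q := by
    refine ⟨(injective_iff_map_eq_zero Q).2 fun e he =>
      funext fun i => funext fun j => hQe e j (congrFun he j) i, fun y => ?_⟩
    choose e he using fun j => (hcol j).2 (y j)
    exact ⟨fun i j => e j i, funext he⟩
  let P' := LinearEquiv.ofBijective P hP
  let Q' := LinearEquiv.ofBijective Q hQ
  have hA₀P : ∀ e, (P'.symm.trans Q') (P e) = Q e := fun e => by
    have : P'.symm (P e) = e := P'.symm_apply_apply e
    simp only [LinearEquiv.trans_apply, this]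
    rfl
  refine ⟨P'.symm.trans Q', fun i j => ?_, fun A hA => ?_⟩
  · have hη := isBiHinge_relChi (P'.symm.trans Q')
    generalize hηdef : relChi (P'.symm.trans Q').toLinearMap = η at hη
    have hGη : ∀ i j, G i j ≤ η i j := by
      intro i j g hg
      subst hηdef
      let e : (i : Fin p) → (j : Fin q) → G i j := Pi.single i (Pi.single j ⟨g, hg⟩)
      have e_self : e i j = ⟨g, hg⟩ := by simp [e]
      have e_left : ∀ i', i' ≠ i → e i' = 0 := fun i' hi' => by simp [e, hi']
      have e_right : ∀ i' j', j' ≠ j → e i' j' = 0 := fun i' j' hj' => by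
        by_cases hi' : i' = i
        · subst hi'; simp [e, hj']
        · rw [e_left i' hi']; rfl
      refine mem_relChi.2 ⟨P e, fun i' hi' => ?_, fun j' hj' => ?_, ?_, ?_⟩
      · rw [P_apply]
        exact Finset.sum_eq_zero fun j' _ => by rw [e_left i' hi'.ne']; rfl
      · rw [LinearEquiv.coe_coe, hA₀P, Q_apply]
        exact Finset.sum_eq_zero fun i' _ => by rw [e_right i' j' hj'.ne]; rfl
      · rw [P_apply, Finset.sum_eq_single j (fun j' _ hj' => by rw [e_right i j' hj']; rfl)
          fun hj => absurd (Finset.mem_univ j) hj, e_self]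
      · rw [LinearEquiv.coe_coe, hA₀P, Q_apply,
          Finset.sum_eq_single i (fun i' _ hi' => by rw [e_left i' hi']; rfl)
            fun hi => absurd (Finset.mem_univ i) hi, e_self]
    have hker : ∀ i j, rker (ξ i j) ≤ rker (η i j) := by
      intro i j
      induction j using (wellFounded_gt (α := Fin q)).induction with
      | _ j ih =>
        intro v hv
        rcases h.mem_rker_iff.1 hv with h0 | ⟨j', hj', hv'⟩
        · rw [h0]; exact zero_mem _
        · obtain ⟨w, hw⟩ := mem_rdom.1 hv'
          obtain ⟨g, hg, h1, -⟩ := hGsum i j' _ hw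
          refine hη.mem_rker_iff.2 (Or.inr ⟨j', hj', mem_rdom.2 ⟨g.2, ?_⟩⟩)
          convert (η i j').add_mem (mem_rker.1 (ih j' hj' h1)) (hGη i j' hg) using 1
          exact Prod.ext (by simp) (by simp)
    have hindef : ∀ i j, rindef (ξ i j) ≤ rindef (η i j) := by
      intro i j
      induction i using (wellFounded_lt (α := Fin p)).induction with
      | _ i ih =>
        intro w hw
        rcases h.mem_rindef_iff.1 hw with h0 | ⟨i', hi', hw'⟩
        · rw [h0]; exact zero_mem _
        · obtain ⟨v, hv⟩ := mem_rim.1 hw'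
          obtain ⟨g, hg, -, h1⟩ := hGsum i' j _ hv
          refine hη.mem_rindef_iff.2 (Or.inr ⟨i', hi', mem_rim.2 ⟨g.1, ?_⟩⟩)
          convert (η i' j).add_mem (mem_rindef.1 (ih i' hi' h1)) (hGη i' j hg) using 1
          exact Prod.ext (by simp) (by simp)
    refine (h.eq_of_le hη (fun i j z hz => ?_) i j).symm
    obtain ⟨g, hg, h1, h2⟩ := hGsum i j z hz
    convert (η i j).add_mem ((η i j).add_mem (mem_rker.1 (hker i j h1))
      (mem_rindef.1 (hindef i j h2))) (hGη i j hg) using 1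
    exact Prod.ext (by simp) (by simp)
  · have hsec : ∀ i j, ∃ s : G i j →ₗ[k] ((i : Fin p) → Fin (α i) → k), ∀ g : G i j,
        (∀ i', i < i' → s g i' = 0) ∧ (∀ j', j' < j → A (s g) j' = 0) ∧
          s g i = g.1.1 ∧ A (s g) j = g.1.2 := by
      intro i j
      have hle : G i j ≤ relChi A.toLinearMap i j := (hA i j).symm ▸ hGle i j
      obtain ⟨t, ht⟩ := LinearMap.exists_rightInverse_of_surjective
        (((LinearMap.proj i).prod (LinearMap.proj j ∘ₗ A.toLinearMap)).submoduleMap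
          (bifilt A.toLinearMap i j))
        (LinearMap.range_eq_top.2 (LinearMap.submoduleMap_surjective _ _))
      refine ⟨(bifilt A.toLinearMap i j).subtype ∘ₗ t ∘ₗ Submodule.inclusion hle, fun g => ?_⟩
      have h1 := congrArg Subtype.val (LinearMap.congr_fun ht (Submodule.inclusion hle g))
      have h2 := (t (Submodule.inclusion hle g)).2
      exact ⟨h2.1, h2.2, congrArg Prod.fst h1, congrArg Prod.snd h1⟩
    choose s hs₁ hs₂ hs₃ hs₄ using hsec
    let S : ((i : Fin p) → (j : Fin q) → G i j) →ₗ[k] ((i : Fin p) → Fin (α i) → k) :=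
      ∑ i, ∑ j, s i j ∘ₗ LinearMap.proj j ∘ₗ LinearMap.proj i
    have hS : ∀ e, S e = ∑ i, ∑ j, s i j (e i j) := fun e => by simp [S]
    have hC : IsUnip (· < ·) (S ∘ₗ P'.symm.toLinearMap) := by
      intro i x hx
      obtain ⟨e, rfl⟩ := hP.2 x
      have he : P'.symm (P e) = e := P'.symm_apply_apply e
      simp only [LinearMap.comp_apply, LinearEquiv.coe_coe, he, hS, Finset.sum_apply]
      refine (Finset.sum_eq_single i (fun i' _ hi' => ?_) (by simp)).trans ?_
      · refine Finset.sum_eq_zero fun j _ => ?_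
        rcases lt_or_gt_of_ne hi' with h' | h'
        · exact hs₁ i' j _ i h'
        · rw [hPe e i' (hx i' h')]; simp
      · exact Finset.sum_congr rfl fun j _ => hs₃ i j _
    have hB : IsUnip (· > ·) (A.toLinearMap ∘ₗ S ∘ₗ Q'.symm.toLinearMap) := by
      intro j y hy
      obtain ⟨e, rfl⟩ := hQ.2 y
      have he : Q'.symm (Q e) = e := Q'.symm_apply_apply e
      simp only [LinearMap.comp_apply, LinearEquiv.coe_coe, he, hS, map_sum, Finset.sum_apply]
      refine Finset.sum_congr rfl fun i _ =>
        (Finset.sum_eq_single j (fun j' _ hj' => ?_) (by simp)).trans (hs₄ i j _)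
      rcases lt_or_gt_of_ne hj' with h' | h'
      · rw [hQe e j' (hy j' h') i]; simp
      · exact hs₂ i j' _ j h'
    refine ⟨hB.toEquiv, hC.toEquiv, hB, hC, ?_⟩
    ext1 x
    change A (S (P'.symm x)) = A (S (Q'.symm (Q' (P'.symm x))))
    rw [Q'.symm_apply_apply]

theorem relChi_eq_iff (hp : 0 < p) (hq : 0 < q)
    (A A' : ((i : Fin p) → Fin (α i) → k) ≃ₗ[k] ((j : Fin q) → Fin (β j) → k)) :
    (∀ i j, relChi A.toLinearMap i j = relChi A'.toLinearMap i j) ↔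
      ∃ (B : ((j : Fin q) → Fin (β j) → k) ≃ₗ[k] ((j : Fin q) → Fin (β j) → k))
        (C : ((i : Fin p) → Fin (α i) → k) ≃ₗ[k] ((i : Fin p) → Fin (α i) → k)),
        IsUnip (· > ·) B.toLinearMap ∧ IsUnip (· < ·) C.toLinearMap ∧
          A' = C.trans (A.trans B) := by
  constructor
  · intro h
    obtain ⟨A₀, -, hA₀⟩ := (isBiHinge_relChi A').exists_normal_form hp hq
    obtain ⟨B₁, C₁, hB₁, hC₁, h₁⟩ := hA₀ A h
    obtain ⟨B₂, C₂, hB₂, hC₂, h₂⟩ := hA₀ A' fun _ _ => rfl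
    refine ⟨B₁.symm.trans B₂, C₂.symm.trans C₁, hB₁.symm.comp hB₂, hC₂.symm.comp hC₁, ?_⟩
    ext1 x
    have e₁ := LinearEquiv.congr_fun h₁ (C₂.symm x)
    have e₂ := LinearEquiv.congr_fun h₂ (C₂.symm x)
    simp only [LinearEquiv.trans_apply, LinearEquiv.apply_symm_apply] at e₁ e₂ ⊢
    rw [e₁, e₂, LinearEquiv.symm_apply_apply]
  · rintro ⟨B, C, hB, hC, rfl⟩ i j
    exact (relChi_eq_of_unip A hB hC i j).symm

end BiHinge

/-! ### Block coordinates -/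

section Blocks

variable {p q n : ℕ} {α : Fin p → ℕ} {β : Fin q → ℕ}

theorem off_add_le_off (α : Fin p → ℕ) {i i' : Fin p} (h : i < i') :
    off α i + α i ≤ off α i' := by
  have h1 : off α i + α i = ∑ l ∈ Finset.Iic i, α l := by
    rw [← Finset.Iio_insert i, Finset.sum_insert (by simp), off, add_comm]
  rw [h1]
  exact Finset.sum_le_sum_of_subset fun l hl =>
    Finset.mem_Iio.2 ((Finset.mem_Iic.1 hl).trans_lt h)

theorem off_le_coord_iff (hα : ∑ i, α i = n) {m i : Fin p} {t : Fin (α i)} :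
    off α m ≤ (coord hα i t : ℕ) ↔ m ≤ i := by
  have hc : (coord hα i t : ℕ) = off α i + t := rfl
  have ht := t.isLt
  constructor
  · intro h
    by_contra hm
    have := off_add_le_off α (not_le.1 hm)
    omega
  · intro h
    rcases h.eq_or_lt with rfl | h
    · omega
    · have := off_add_le_off α h
      omega

theorem off_add_le_coord_iff (hα : ∑ i, α i = n) {m i : Fin p} {t : Fin (α i)} :
    off α m + α m ≤ (coord hα i t : ℕ) ↔ m < i := by
  have hc : (coord hα i t : ℕ) = off α i + t := rfl
  have ht := t.isLt
  constructor
  · intro h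
    refine lt_of_le_of_ne ((off_le_coord_iff hα (t := t)).1 (by omega)) ?_
    rintro rfl
    omega
  · intro h
    have := off_add_le_off α h
    omega

theorem coord_bijective (hα : ∑ i, α i = n) :
    Function.Bijective fun z : Σ i, Fin (α i) => coord hα z.1 z.2 := by
  rw [Fintype.bijective_iff_injective_and_card]
  refine ⟨?_, by simp [hα]⟩
  rintro ⟨i, t⟩ ⟨i', t'⟩ h
  have h' : coord hα i t = coord hα i' t' := h
  obtain rfl : i = i' := le_antisymm
    ((off_le_coord_iff hα).1 (h' ▸ (off_le_coord_iff hα).2 le_rfl))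
    ((off_le_coord_iff hα (t := t)).1 (h' ▸ (off_le_coord_iff hα).2 le_rfl))
  have h2 : off α i + (t : ℕ) = off α i + t' := congrArg Fin.val h'
  rw [Fin.ext (Nat.add_left_cancel h2)]

/-- Splitting a vector into its blocks. -/
noncomputable def blocks (hα : ∑ i, α i = n) :
    (Fin n → k) ≃ₗ[k] ((i : Fin p) → Fin (α i) → k) :=
  LinearEquiv.ofBijective (LinearMap.pi fun i => LinearMap.funLeft k k (coord hα i)) <| by
    refine ⟨(injective_iff_map_eq_zero _).2 fun x hx => ?_, fun y => ?_⟩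
    · ext r
      obtain ⟨⟨i, t⟩, rfl⟩ := (coord_bijective hα).2 r
      exact congrFun (congrFun hx i) t
    · let e := Equiv.ofBijective _ (coord_bijective hα)
      refine ⟨fun r => y (e.symm r).1 (e.symm r).2, ?_⟩
      ext i t
      change y (e.symm (e ⟨i, t⟩)).1 (e.symm (e ⟨i, t⟩)).2 = y i t
      rw [e.symm_apply_apply]

theorem blocks_apply (hα : ∑ i, α i = n) (x : Fin n → k) (i : Fin p) (t : Fin (α i)) :
    blocks hα x i t = x (coord hα i t) := rfl

/-- Invertible matrices as automorphisms of the coordinate space. -/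
noncomputable def glEquiv (n : ℕ) : GL (Fin n) k ≃* ((Fin n → k) ≃ₗ[k] (Fin n → k)) :=
  Matrix.GeneralLinearGroup.toLin.trans (LinearMap.GeneralLinearGroup.generalLinearEquiv k _)

theorem glEquiv_apply (A : GL (Fin n) k) (x : Fin n → k) :
    glEquiv n A x = A.val.mulVec x := rfl

/-- An automorphism of `k^n` read in block coordinates. -/
noncomputable def blockMap (hα : ∑ i, α i = n) (hβ : ∑ j, β j = n) (A : GL (Fin n) k) :
    ((i : Fin p) → Fin (α i) → k) ≃ₗ[k] ((j : Fin q) → Fin (β j) → k) :=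
  (blocks hα).symm.trans ((glEquiv n A).trans (blocks hβ))

theorem blockMap_surjective (hα : ∑ i, α i = n) (hβ : ∑ j, β j = n) :
    Function.Surjective (blockMap (k := k) hα hβ) := fun f =>
  ⟨(glEquiv n).symm ((blocks hα).trans (f.trans (blocks hβ).symm)), by
    ext1 x
    simp [blockMap]⟩

theorem blockMap_injective (hα : ∑ i, α i = n) (hβ : ∑ j, β j = n) :
    Function.Injective (blockMap (k := k) hα hβ) := fun A A' h => by
  apply (glEquiv n).injective
  ext1 x
  have := LinearEquiv.congr_fun h (blocks hα x)
  simpa [blockMap] using this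

theorem blockMap_mul_mul (hα : ∑ i, α i = n) (hβ : ∑ j, β j = n) (A B C : GL (Fin n) k) :
    blockMap hα hβ (B * A * C) =
      (blockMap hα hα C).trans ((blockMap hα hβ A).trans (blockMap hβ hβ B)) := by
  ext1 x
  simp [blockMap]

theorem mem_vanishOn {ι : Type*} {P : ι → Prop} {x : ι → k} :
    x ∈ vanishOn (k := k) P ↔ ∀ r, P r → x r = 0 := by
  simp [vanishOn]

theorem chi_eq_relChi (hα : ∑ i, α i = n) (hβ : ∑ j, β j = n) (A : GL (Fin n) k) (i : Fin p)
    (j : Fin q) : chi α β hα hβ A.val i j = relChi (blockMap hα hβ A).toLinearMap i j := by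
  have hx : ∀ x : Fin n → k,
      x ∈ vanishOn (k := k) (fun r : Fin n => off α i + α i ≤ (r : ℕ)) ↔
        ∀ i', i < i' → blocks hα x i' = 0 := by
    intro x
    rw [mem_vanishOn]
    constructor
    · exact fun h i' hi' => funext fun t => h _ ((off_add_le_coord_iff hα).2 hi')
    · intro h r hr
      obtain ⟨⟨i', t⟩, rfl⟩ := (coord_bijective hα).2 r
      exact congrFun (h i' ((off_add_le_coord_iff hα).1 hr)) t
  have hy : ∀ y : Fin n → k,
      y ∈ vanishOn (k := k) (fun r : Fin n => (r : ℕ) < off β j) ↔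
        ∀ j', j' < j → blocks hβ y j' = 0 := by
    intro y
    rw [mem_vanishOn]
    constructor
    · exact fun h j' hj' => funext fun t =>
        h _ (not_le.1 fun h' => hj'.not_ge ((off_le_coord_iff hβ).1 h'))
    · intro h r hr
      obtain ⟨⟨j', t⟩, rfl⟩ := (coord_bijective hβ).2 r
      exact congrFun (h j' (not_le.1 fun h' => hr.not_ge ((off_le_coord_iff hβ).2 h'))) t
  ext z
  rw [mem_relChi]
  constructor
  · rintro ⟨x, ⟨h1, h2⟩, rfl⟩
    refine ⟨blocks hα x, (hx x).1 h1, ?_, rfl, ?_⟩ <;>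
      simp only [blockMap, LinearEquiv.coe_coe, LinearEquiv.trans_apply,
        LinearEquiv.symm_apply_apply]
    · exact (hy _).1 h2
    · rfl
  · rintro ⟨x, h1, h2, h3, h4⟩
    refine ⟨(blocks hα).symm x, ⟨(hx _).2 (by simpa using h1), (hy _).2 h2⟩, Prod.ext ?_ h4⟩
    rw [← h3]
    change blocks hα ((blocks hα).symm x) i = x i
    rw [LinearEquiv.apply_symm_apply]

theorem sameBlock_coord_iff (hα : ∑ i, α i = n) {i i' : Fin p} {t : Fin (α i)}
    {t' : Fin (α i')} : sameBlock α (coord hα i t : ℕ) (coord hα i' t' : ℕ) ↔ i = i' := by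
  simp only [sameBlock, off_le_coord_iff]
  exact ⟨fun h => le_antisymm ((h i).1 le_rfl) ((h i').2 le_rfl), fun h m => by rw [h]⟩

theorem blockLT_coord_iff (hα : ∑ i, α i = n) {i i' : Fin p} {t : Fin (α i)}
    {t' : Fin (α i')} : blockLT α (coord hα i t : ℕ) (coord hα i' t' : ℕ) ↔ i < i' := by
  simp only [blockLT, off_le_coord_iff, ← not_le]
  exact ⟨fun ⟨m, h1, h2⟩ h => h2 (h1.trans h), fun h => ⟨i', le_rfl, h⟩⟩

theorem isUnip_blockMap_iff (hα : ∑ i, α i = n) (R : Fin p → Fin p → Prop)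
    [IsStrictTotalOrder (Fin p) R] (C : GL (Fin n) k) :
    IsUnip R (blockMap hα hα C).toLinearMap ↔
      ∀ i t i' t', R i' i ∨ i = i' →
        C.val (coord hα i t) (coord hα i' t') = if coord hα i t = coord hα i' t' then 1 else 0 := by
  have happ : ∀ x i t, blockMap hα hα C (blocks hα x) i t = C.val.mulVec x (coord hα i t) := by
    intro x i t
    simp [blockMap, blocks_apply, glEquiv_apply]
  constructor
  · intro h i t i' t' hi
    have hx : ∀ l, R i l → blocks hα (Pi.single (coord hα i' t') (1 : k)) l = 0 := by
      intro l hl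
      ext u
      rw [blocks_apply, Pi.single_apply, if_neg]
      · rfl
      · intro hc
        have := (sameBlock_coord_iff hα (t := u) (t' := t')).1 (by rw [hc]; exact fun _ => Iff.rfl)
        subst this
        rcases hi with hi | rfl
        · exact asymm_of R hi hl
        · exact irrefl_of R _ hl
    have h1 := congrFun (h i _ hx) t
    rw [LinearEquiv.coe_coe, happ, blocks_apply, Matrix.mulVec_single_one, Pi.single_apply] at h1
    exact h1
  · intro h i x hx
    obtain ⟨x, rfl⟩ := (blocks hα).surjective x
    ext t
    rw [LinearEquiv.coe_coe, happ, blocks_apply, Matrix.mulVec, dotProduct,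
      Finset.sum_eq_single (coord hα i t)]
    · rw [h i t i t (Or.inr rfl), if_pos rfl, one_mul]
    · intro s _ hs
      obtain ⟨⟨i', t'⟩, rfl⟩ := (coord_bijective hα).2 s
      rcases trichotomous_of R i i' with hi | hi | hi
      · have : x (coord hα i' t') = 0 := congrFun (hx i' hi) t'
        simp [this]
      · rw [h i t i' t' (Or.inr hi), if_neg hs.symm, zero_mul]
      · rw [h i t i' t' (Or.inl hi), if_neg hs.symm, zero_mul]
    · simp

theorem isTPlus_iff (hα : ∑ i, α i = n) (C : GL (Fin n) k) :
    IsTPlus α C.val ↔ IsUnip (· < ·) (blockMap hα hα C).toLinearMap := by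
  rw [isUnip_blockMap_iff]
  constructor
  · rintro ⟨h1, h2⟩ i t i' t' (hi | hi)
    · rw [h1 _ _ ((blockLT_coord_iff hα).2 hi), if_neg]
      intro hc
      exact hi.ne' ((sameBlock_coord_iff hα (t := t) (t' := t')).1
        (by rw [hc]; exact fun _ => Iff.rfl))
    · exact h2 _ _ ((sameBlock_coord_iff hα).2 hi)
  · intro h
    refine ⟨fun r s hrs => ?_, fun r s hrs => ?_⟩ <;>
      obtain ⟨⟨i, t⟩, rfl⟩ := (coord_bijective hα).2 r <;>
      obtain ⟨⟨i', t'⟩, rfl⟩ := (coord_bijective hα).2 s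
    · have hi := (blockLT_coord_iff hα).1 hrs
      rw [h i t i' t' (Or.inl hi), if_neg]
      intro hc
      exact hi.ne' ((sameBlock_coord_iff hα (t := t) (t' := t')).1
        (by rw [hc]; exact fun _ => Iff.rfl))
    · exact h i t i' t' (Or.inr ((sameBlock_coord_iff hα).1 hrs))

theorem isTMinus_iff (hα : ∑ i, α i = n) (C : GL (Fin n) k) :
    IsTMinus α C.val ↔ IsUnip (· > ·) (blockMap hα hα C).toLinearMap := by
  rw [isUnip_blockMap_iff]
  constructor
  · rintro ⟨h1, h2⟩ i t i' t' (hi | hi)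
    · rw [h1 _ _ ((blockLT_coord_iff hα).2 hi), if_neg]
      intro hc
      exact hi.ne' ((sameBlock_coord_iff hα (t := t) (t' := t')).1
        (by rw [hc]; exact fun _ => Iff.rfl)).symm
    · exact h2 _ _ ((sameBlock_coord_iff hα).2 hi)
  · intro h
    refine ⟨fun r s hrs => ?_, fun r s hrs => ?_⟩ <;>
      obtain ⟨⟨i, t⟩, rfl⟩ := (coord_bijective hα).2 r <;>
      obtain ⟨⟨i', t'⟩, rfl⟩ := (coord_bijective hα).2 s
    · have hi := (blockLT_coord_iff hα).1 hrs
      rw [h i t i' t' (Or.inl hi), if_neg]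
      intro hc
      exact hi.ne ((sameBlock_coord_iff hα (t := t) (t' := t')).1
        (by rw [hc]; exact fun _ => Iff.rfl))
    · exact h i t i' t' (Or.inr ((sameBlock_coord_iff hα).1 hrs))

end Blocks

theorem statement7 (p q n : ℕ) (hp : 0 < p) (hq : 0 < q)
    (α : Fin p → ℕ) (β : Fin q → ℕ)
    (hαpos : ∀ i, 0 < α i) (hβpos : ∀ j, 0 < β j)
    (hα : ∑ i, α i = n) (hβ : ∑ j, β j = n) :
    (∀ A : GL (Fin n) k, IsBiHinge α β (chi α β hα hβ A.val)) ∧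
    (∀ A A' : GL (Fin n) k,
      (∀ (i : Fin p) (j : Fin q), chi α β hα hβ A.val i j = chi α β hα hβ A'.val i j) ↔
        ∃ B C : GL (Fin n) k, IsTMinus β B.val ∧ IsTPlus α C.val ∧ A' = B * A * C) ∧
    (∀ ξ : (i : Fin p) → (j : Fin q) → Submodule k ((Fin (α i) → k) × (Fin (β j) → k)),
      IsBiHinge α β ξ →
        ∃ A : GL (Fin n) k, ∀ (i : Fin p) (j : Fin q), chi α β hα hβ A.val i j = ξ i j) := by
  refine ⟨fun A => ?_, fun A A' => ?_, fun ξ hξ => ?_⟩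
  · have : chi α β hα hβ A.val = relChi (blockMap hα hβ A).toLinearMap :=
      funext fun i => funext fun j => chi_eq_relChi hα hβ A i j
    rw [this]
    exact isBiHinge_relChi _
  · simp only [chi_eq_relChi, relChi_eq_iff hp hq, isTMinus_iff hβ, isTPlus_iff hα]
    constructor
    · rintro ⟨B, C, hB, hC, h⟩
      obtain ⟨B, rfl⟩ := blockMap_surjective hβ hβ B
      obtain ⟨C, rfl⟩ := blockMap_surjective hα hα C
      exact ⟨B, C, hB, hC, blockMap_injective hα hβ (h.trans (blockMap_mul_mul hα hβ A B C).symm)⟩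
    · rintro ⟨B, C, hB, hC, rfl⟩
      exact ⟨_, _, hB, hC, blockMap_mul_mul hα hβ A B C⟩
  · obtain ⟨A₀, hA₀, -⟩ := hξ.exists_normal_form hp hq
    obtain ⟨A, rfl⟩ := blockMap_surjective hα hβ A₀
    exact ⟨A, fun i j => (chi_eq_relChi hα hβ A i j).trans (hA₀ i j)⟩

end Neretin
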